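/- Let f : ℂ → ℂ be an entire function satisfying the quasi-periodicity equation f(z+m) = e^{2πiαm} e^{ν(z+m/2)m} f(z) for all z ∈ ℂ and all m ∈ ℤ, and let (aₙ)_{n∈ℤ} be complex numbers such that f(z) = Σ_{n∈ℤ} aₙ e^{(ν/2)z² + 2πi(α+n)z} with locally uniform convergence on ℂ. Then ∫_S |f(z)|² e^{−ν|z|²} dm(z) = (π/(2ν))^{1/2} Σ_{n∈ℤ} e^{(2π²/ν)(n+α)²} |aₙ|², as an identity in [0,∞]; in particular the left-hand side is finite if and only if the series on the right converges. -/

import Mathlib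

open Complex MeasureTheory ENNReal

/-- The Parseval identity for an absolutely convergent Fourier series on the unit interval. -/
lemma lintegral_sq_enorm_of_hasSum_fourier {c : ℤ → ℂ} {h : ℝ → ℂ}
    (hc : ∀ x : ℝ, HasSum (fun n : ℤ => c n * cexp (2 * Real.pi * I * n * x)) (h x)) :
    ∫⁻ x in Set.Icc (0 : ℝ) 1, ‖h x‖ₑ ^ 2 = ∑' n, ‖c n‖ₑ ^ 2 := by
  have hsum : Summable fun n => ‖c n • fourier (T := 1) n‖ := by
    simpa only [norm_smul, fourier_norm, mul_one, Complex.ofReal_zero, mul_zero, Complex.exp_zero]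
      using (hc 0).summable.norm
  obtain ⟨F, hF⟩ := hsum.of_norm
  have hFh (x : ℝ) : F (x : AddCircle (1 : ℝ)) = h x := by
    refine HasSum.unique
      (hF.map (ContinuousMap.evalCLM ℂ (x : AddCircle (1 : ℝ))) (ContinuousLinearMap.continuous _))
      ((hc x).congr_fun fun n => ?_)
    simp
  have hcoeff (n : ℤ) : fourierCoeff F n = c n := by
    have hL := hF.map (ContinuousMap.toLp (E := ℂ) 2 AddCircle.haarAddCircle ℂ)
      (ContinuousLinearMap.continuous _)
    rw [← fourierCoeff_toLp, ← fourierBasis_repr, fourierBasis.repr_apply_apply, coe_fourierBasis]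
    refine HasSum.unique (hL.mapL (innerSL ℂ (fourierLp 2 n))) ?_
    refine (hasSum_ite_eq n (c n)).congr_fun fun m => ?_
    have := (orthonormal_iff_ite.mp (orthonormal_fourier (T := 1))) n m
    simp only [Function.comp_apply, map_smul, innerSL_apply_apply]
    erw [this]
    by_cases hnm : n = m <;> simp [hnm, eq_comm]
  have hP := hasSum_sq_fourierCoeff (ContinuousMap.toLp (E := ℂ) 2 AddCircle.haarAddCircle ℂ F)
  have hint : ∫ t, ‖ContinuousMap.toLp (E := ℂ) 2 AddCircle.haarAddCircle ℂ F t‖ ^ 2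
      ∂AddCircle.haarAddCircle = ∫ t, ‖F t‖ ^ 2 ∂(volume : Measure (AddCircle (1 : ℝ))) := by
    rw [AddCircle.volume_eq_smul_haarAddCircle, ENNReal.ofReal_one, one_smul]
    refine integral_congr_ae ?_
    filter_upwards [ContinuousMap.coeFn_toLp (𝕜 := ℂ) (p := 2) AddCircle.haarAddCircle F] with t ht
    rw [ht]
  simp only [fourierCoeff_toLp, hcoeff, hint] at hP
  have hFint : Integrable (fun t => ‖F t‖ ^ 2) (volume : Measure (AddCircle (1 : ℝ))) :=
    (F.continuous.norm.pow 2).integrable_of_hasCompactSupport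
      (HasCompactSupport.of_compactSpace _)
  have henorm (w : ℂ) : ENNReal.ofReal (‖w‖ ^ 2) = ‖w‖ₑ ^ 2 := by
    rw [ENNReal.ofReal_pow (norm_nonneg _), ofReal_norm]
  calc ∫⁻ x in Set.Icc (0 : ℝ) 1, ‖h x‖ₑ ^ 2
      = ∫⁻ x in Set.Ioc (0 : ℝ) (0 + 1), ‖F (x : AddCircle (1 : ℝ))‖ₑ ^ 2 := by
        rw [zero_add, setLIntegral_congr Ioc_ae_eq_Icc.symm]
        simp only [hFh]
    _ = ∫⁻ t : AddCircle (1 : ℝ), ‖F t‖ₑ ^ 2 :=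
        AddCircle.lintegral_preimage 1 0 fun t => ‖F t‖ₑ ^ 2
    _ = ENNReal.ofReal (∫ t : AddCircle (1 : ℝ), ‖F t‖ ^ 2) := by
        rw [ofReal_integral_eq_lintegral_ofReal hFint (.of_forall fun _ => by positivity)]
        simp only [henorm]
    _ = ∑' n, ‖c n‖ₑ ^ 2 := by
        rw [← hP.tsum_eq, ENNReal.ofReal_tsum_of_nonneg (fun _ => by positivity) hP.summable]
        simp only [henorm]

/-- The Gaussian integral with a linear term, as an identity in `[0,∞]`. -/
lemma lintegral_exp_neg_mul_sq_add {b : ℝ} (hb : 0 < b) (t : ℝ) :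
    ∫⁻ y : ℝ, ENNReal.ofReal (Real.exp (-b * y ^ 2 - t * y)) =
      ENNReal.ofReal ((Real.pi / b) ^ ((1 : ℝ) / 2)) *
        ENNReal.ofReal (Real.exp (t ^ 2 / (4 * b))) := by
  calc ∫⁻ y : ℝ, ENNReal.ofReal (Real.exp (-b * y ^ 2 - t * y))
      = ∫⁻ y : ℝ, ENNReal.ofReal (Real.exp (-b * (y + t / (2 * b)) ^ 2)) *
          ENNReal.ofReal (Real.exp (t ^ 2 / (4 * b))) := by
        refine lintegral_congr fun y => ?_
        rw [← ENNReal.ofReal_mul (Real.exp_pos _).le, ← Real.exp_add]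
        congr 2
        field_simp
        ring
    _ = _ := by
        rw [lintegral_mul_const _ (by fun_prop),
          lintegral_add_right_eq_self (fun y => ENNReal.ofReal (Real.exp (-b * y ^ 2))),
          ← ofReal_integral_eq_lintegral_ofReal (integrable_exp_neg_mul_sq hb)
            (.of_forall fun _ => (Real.exp_pos _).le), integral_gaussian, Real.sqrt_eq_rpow]

/-- The Tonelli theorem on the strip `0 ≤ Re z ≤ 1`, integrating over the real part first. -/
lemma setLIntegral_strip {g : ℂ → ℝ≥0∞} (hg : Measurable g) :
    ∫⁻ z in {z : ℂ | z.re ∈ Set.Icc (0 : ℝ) 1}, g z =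
      ∫⁻ y : ℝ, ∫⁻ x in Set.Icc (0 : ℝ) 1, g (x + y * I) := by
  have hgm : Measurable fun p : ℝ × ℝ => g (p.1 + p.2 * I) := hg.comp (by fun_prop)
  have hpre : {z : ℂ | z.re ∈ Set.Icc (0 : ℝ) 1} =
      measurableEquivRealProd ⁻¹' (Set.Icc (0 : ℝ) 1 ×ˢ Set.univ) := by
    ext z
    simp
  have := volume_preserving_equiv_real_prod.setLIntegral_comp_preimage
    (measurableSet_Icc.prod MeasurableSet.univ : MeasurableSet (Set.Icc (0 : ℝ) 1 ×ˢ Set.univ)) hgm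
  simp only [measurableEquivRealProd_apply, re_add_im] at this
  rw [hpre, this, Measure.volume_eq_prod, ← Measure.prod_restrict, Measure.restrict_univ,
    lintegral_prod_symm' _ hgm]

/-- The integral of `|f(z)|² e^{−ν|z|²}` along the horizontal segment at height `y`. -/
lemma lintegral_horizontal_segment {α ν : ℝ} {f : ℂ → ℂ} {a : ℤ → ℂ}
    (ha : ∀ z : ℂ, HasSum (fun n : ℤ =>
      a n * cexp (ν / 2 * z ^ 2 + 2 * Real.pi * I * (α + n) * z)) (f z)) (y : ℝ) :
    ∫⁻ x in Set.Icc (0 : ℝ) 1, ‖f (x + y * I)‖ₑ ^ 2 *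
        ENNReal.ofReal (Real.exp (-ν * normSq (x + y * I))) =
      ∑' n : ℤ, ENNReal.ofReal (Real.exp (-(2 * ν) * y ^ 2 - 4 * Real.pi * (n + α) * y)) *
        ‖a n‖ₑ ^ 2 := by
  have hexp (w : ℂ) : ‖cexp w‖ₑ ^ 2 = ENNReal.ofReal (Real.exp (2 * w.re)) := by
    rw [← ofReal_norm, ← ENNReal.ofReal_pow (norm_nonneg _), norm_exp, ← Real.exp_nat_mul]
    norm_num
  have key := lintegral_sq_enorm_of_hasSum_fourier
    (c := fun n : ℤ => a n * cexp (-(ν * y ^ 2) - 2 * Real.pi * (α + n) * y))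
    (h := fun x : ℝ => f (x + y * I) *
      cexp (-(ν / 2 * (x + y * I) ^ 2) - 2 * Real.pi * I * α * x - ν * y ^ 2)) fun x => by
    refine ((ha (x + y * I)).mul_right _).congr_fun fun n => ?_
    rw [mul_assoc (a n), mul_assoc (a n), ← Complex.exp_add, ← Complex.exp_add]
    congr 2
    linear_combination (-2 * Real.pi * (α + n) * y) * I_sq
  simp only [enorm_mul, mul_pow, hexp] at key
  convert key using 1
  · refine lintegral_congr fun x => ?_
    congr 3
    simp [normSq_apply, pow_two]
    ring
  · refine tsum_congr fun n => ?_
    rw [mul_comm]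
    congr 3
    simp [pow_two]
    ring

/-- If the entire quasi-periodic function `f` has the expansion
`f(z) = Σ_{n∈ℤ} aₙ e^{(ν/2)z² + 2πi(α+n)z}` with locally uniform convergence, then
`∫_S |f(z)|² e^{−ν|z|²} dm(z) = (π/(2ν))^{1/2} Σ_{n∈ℤ} e^{(2π²/ν)(n+α)²} |aₙ|²`
as an identity in `[0,∞]`. -/
theorem stmt_4 (α ν : ℝ) (hν : 0 < ν) (f : ℂ → ℂ) (hf : Differentiable ℂ f)
    (hqp : ∀ (z : ℂ) (m : ℤ), f (z + m) =
        Complex.exp (2 * Real.pi * Complex.I * α * m) *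
          Complex.exp (ν * (z + m / 2) * m) * f z)
    (a : ℤ → ℂ)
    (ha : TendstoLocallyUniformly
      (fun (s : Finset ℤ) (z : ℂ) =>
        ∑ n ∈ s, a n * Complex.exp (ν / 2 * z ^ 2 + 2 * Real.pi * Complex.I * (α + n) * z))
      f Filter.atTop) :
    (∫⁻ z in {z : ℂ | z.re ∈ Set.Icc (0 : ℝ) 1},
        (‖f z‖₊ : ℝ≥0∞) ^ 2 * ENNReal.ofReal (Real.exp (-ν * Complex.normSq z)))
      = ENNReal.ofReal ((Real.pi / (2 * ν)) ^ ((1 : ℝ) / 2)) *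
          ∑' n : ℤ,
            ENNReal.ofReal (Real.exp (2 * Real.pi ^ 2 / ν * (n + α) ^ 2)) *
              (‖a n‖₊ : ℝ≥0∞) ^ 2 := by
  have hsum (z : ℂ) : HasSum (fun n : ℤ =>
      a n * cexp (ν / 2 * z ^ 2 + 2 * Real.pi * I * (α + n) * z)) (f z) :=
    (tendstoLocallyUniformlyOn_univ.mpr ha).tendsto_at (Set.mem_univ z)
  have hmeas : Measurable fun z : ℂ =>
      ‖f z‖ₑ ^ 2 * ENNReal.ofReal (Real.exp (-ν * normSq z)) := by
    have := hf.continuous.measurable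
    have := Complex.continuous_normSq.measurable
    fun_prop
  simp only [← enorm_eq_nnnorm]
  rw [setLIntegral_strip hmeas]
  simp only [lintegral_horizontal_segment hsum]
  rw [lintegral_tsum fun n => by fun_prop, ← ENNReal.tsum_mul_left]
  refine tsum_congr fun n => ?_
  rw [lintegral_mul_const _ (by fun_prop), lintegral_exp_neg_mul_sq_add (by positivity), mul_assoc]
  congr 4
  field_simp
  ring
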